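/- arXiv:1903.12416 — 4 statements merged into one kernel-verified Lean document; each statement's English description precedes it below -/
import Mathlib

section
/- For every w ∈ Δ'_k, the matrix (n²L/(2γ))·H(w) − g(w)g(w)ᵀ is positive semidefinite, where g(w) = ∑_{i=1}^n ℓ(i)² p(i)/(wᵀp(i))² ∈ ℝ^k and H(w) = 2 ∑_{i=1}^n ℓ(i)² p(i)p(i)ᵀ/(wᵀp(i))³ ∈ ℝ^{k×k} (g(w) is minus the gradient and H(w) is the Hessian of w ↦ ∑_i ℓ(i)²/(wᵀp(i))). -/
open Finset

/-- The probability simplex in `ℝ^k`. -/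
def simplex (k : ℕ) : Set (Fin k → ℝ) :=
  {w | (∀ j, 0 ≤ w j) ∧ ∑ j, w j = 1}

/-- The last index of `Fin k`. -/
def lastIdx (k : ℕ) (hk : 0 < k) : Fin k := ⟨k - 1, Nat.sub_lt hk Nat.one_pos⟩

/-- The restricted simplex: weights in the simplex whose last coordinate is at least `γ`. -/
def restSimplex (k : ℕ) (hk : 0 < k) (γ : ℝ) : Set (Fin k → ℝ) :=
  {w ∈ simplex k | γ ≤ w (lastIdx k hk)}

theorem exp_concavity_matrix_inequality
    (n k : ℕ) (hn : 0 < n) (hk : 0 < k)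
    (L γ : ℝ) (hL : 0 < L) (hγ0 : 0 < γ) (hγ1 : γ ≤ 1)
    (p : Fin k → Fin n → ℝ)
    (hp0 : ∀ j i, 0 ≤ p j i) (hp1 : ∀ j, ∑ i, p j i = 1)
    (hpunif : ∀ i, p (lastIdx k hk) i = 1 / n)
    (ℓ : Fin n → ℝ) (hℓ : ∀ i, (ℓ i) ^ 2 ≤ L)
    (w : Fin k → ℝ) (hw : w ∈ restSimplex k hk γ)
    (g : Fin k → ℝ)
    (hg : g = ∑ i, ((ℓ i) ^ 2 / (∑ j, w j * p j i) ^ 2) • (fun j => p j i))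
    (H : Matrix (Fin k) (Fin k) ℝ)
    (hH : H = (2 : ℝ) • ∑ i, ((ℓ i) ^ 2 / (∑ j, w j * p j i) ^ 3) •
        Matrix.vecMulVec (fun j => p j i) (fun j => p j i)) :
    (((n : ℝ) ^ 2 * L / (2 * γ)) • H - Matrix.vecMulVec g g).PosSemidef := by
  obtain ⟨⟨hw0, hw1⟩, hwγ⟩ := hw
  have hn' : (0 : ℝ) < n := by exact_mod_cast hn
  have hq : ∀ i, γ / n ≤ ∑ j, w j * p j i := by
    intro i
    calc γ / n ≤ w (lastIdx k hk) * p (lastIdx k hk) i := by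
          rw [hpunif, mul_one_div]
          gcongr
      _ ≤ ∑ j, w j * p j i :=
          Finset.single_le_sum (f := fun j => w j * p j i)
            (fun j _ => mul_nonneg (hw0 j) (hp0 j i)) (Finset.mem_univ _)
  generalize hqd : (fun i => ∑ j, w j * p j i) = q at *
  have hqe : ∀ i, ∑ j, w j * p j i = q i := fun i => congrFun hqd i
  simp only [hqe] at hq hg hH
  have hqpos : ∀ i, 0 < q i := fun i => lt_of_lt_of_le (by positivity) (hq i)
  refine Matrix.PosSemidef.of_dotProduct_mulVec_nonneg ?_ ?_
  · ext a b
    simp only [hH, Matrix.conjTranspose_apply, Matrix.sub_apply, Matrix.smul_apply,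
      Matrix.sum_apply, Matrix.vecMulVec_apply, star_trivial, mul_comm]
  · intro x
    have hgx : g ⬝ᵥ x = ∑ i, (ℓ i) ^ 2 / (q i) ^ 2 * ((fun j => p j i) ⬝ᵥ x) := by
      rw [hg, sum_dotProduct]
      simp only [smul_dotProduct, smul_eq_mul]
    have hHx : x ⬝ᵥ (H.mulVec x) =
        2 * ∑ i, (ℓ i) ^ 2 / (q i) ^ 3 * ((fun j => p j i) ⬝ᵥ x) ^ 2 := by
      rw [hH, Matrix.smul_mulVec, Matrix.sum_mulVec, dotProduct_smul, dotProduct_sum, smul_eq_mul]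
      congr 1
      refine Finset.sum_congr rfl fun i _ => ?_
      rw [Matrix.smul_mulVec, dotProduct_smul, Matrix.vecMulVec_mulVec, smul_eq_mul]
      simp [dotProduct_comm x, pow_two]
    have hsum : ∑ i, (ℓ i) ^ 2 / q i ≤ (n : ℝ) ^ 2 * L / γ := by
      calc ∑ i, (ℓ i) ^ 2 / q i ≤ ∑ _i : Fin n, L / (γ / n) := by
            refine Finset.sum_le_sum fun i _ => ?_
            exact div_le_div₀ hL.le (hℓ i) (by positivity) (hq i)
        _ = (n : ℝ) ^ 2 * L / γ := by
            simp
            field_simp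
    have hcs := Finset.sum_sq_le_sum_mul_sum_of_sq_eq_mul Finset.univ
      (r := fun i => (ℓ i) ^ 2 / (q i) ^ 2 * ((fun j => p j i) ⬝ᵥ x))
      (f := fun i => (ℓ i) ^ 2 / (q i) ^ 3 * ((fun j => p j i) ⬝ᵥ x) ^ 2)
      (g := fun i => (ℓ i) ^ 2 / q i)
      (fun i _ => by have := hqpos i; positivity)
      (fun i _ => by have := hqpos i; positivity)
      (fun i _ => by have := hqpos i; field_simp)
    have hS : 0 ≤ ∑ i, (ℓ i) ^ 2 / (q i) ^ 3 * ((fun j => p j i) ⬝ᵥ x) ^ 2 :=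
      Finset.sum_nonneg fun i _ => by have := hqpos i; positivity
    have h2 := hcs.trans (mul_le_mul_of_nonneg_left hsum hS)
    rw [← hgx] at h2
    have hgoal : star x ⬝ᵥ
        ((((n : ℝ) ^ 2 * L / (2 * γ)) • H - Matrix.vecMulVec g g).mulVec x) =
        (n : ℝ) ^ 2 * L / (2 * γ) * (x ⬝ᵥ (H.mulVec x)) - (g ⬝ᵥ x) ^ 2 := by
      rw [star_trivial, Matrix.sub_mulVec, dotProduct_sub, Matrix.smul_mulVec, dotProduct_smul,
        Matrix.vecMulVec_mulVec, smul_eq_mul]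
      simp [dotProduct_comm x g, pow_two]
    rw [hgoal, hHx, sub_nonneg]
    refine h2.trans (le_of_eq ?_)
    field_simp
end

section
/- Each cost function f_t is (2γ/(n²L))-exp-concave on the restricted simplex: the function w ↦ exp(−(2γ/(n²L)) · ∑_{i=1}^n ℓ_t(i)²/(wᵀp(i))) is concave on Δ'_k. -/
open Finset

/-- The scalar function `r ↦ exp (-1/r)` is concave on `[1/2, ∞)`. -/
lemma concave_exp_neg_inv :
    ConcaveOn ℝ (Set.Ici (1 / 2 : ℝ)) (fun r : ℝ => Real.exp (-r⁻¹)) := by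
  have hd : ∀ r : ℝ, 0 < r →
      HasDerivAt (fun r : ℝ => Real.exp (-r⁻¹)) (Real.exp (-r⁻¹) * (r ^ 2)⁻¹) r := by
    intro r hr
    have h := ((hasDerivAt_inv hr.ne').neg).exp
    simpa using h
  have hd2 : ∀ r : ℝ, 0 < r →
      HasDerivAt (fun r : ℝ => Real.exp (-r⁻¹) * (r ^ 2)⁻¹)
        (Real.exp (-r⁻¹) * (1 - 2 * r) / r ^ 4) r := by
    intro r hr
    have h := (hd r hr).mul ((hasDerivAt_pow 2 r).inv (pow_ne_zero 2 hr.ne'))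
    refine h.congr_deriv ?_
    simp
    field_simp
    ring
  refine concaveOn_of_hasDerivWithinAt2_nonpos (convex_Ici _)
    (f' := fun r => Real.exp (-r⁻¹) * (r ^ 2)⁻¹)
    (f'' := fun r => Real.exp (-r⁻¹) * (1 - 2 * r) / r ^ 4) ?_ ?_ ?_ ?_
  · intro r hr
    have hr' : (1 / 2 : ℝ) ≤ r := hr
    exact (hd r (by linarith)).continuousAt.continuousWithinAt
  · intro r hr
    rw [interior_Ici] at hr
    have hr' : (1 / 2 : ℝ) < r := hr
    exact (hd r (by linarith)).hasDerivWithinAt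
  · intro r hr
    rw [interior_Ici] at hr
    have hr' : (1 / 2 : ℝ) < r := hr
    exact (hd2 r (by linarith)).hasDerivWithinAt
  · intro r hr
    rw [interior_Ici] at hr
    have hr' : (1 / 2 : ℝ) < r := hr
    apply div_nonpos_of_nonpos_of_nonneg
    · exact mul_nonpos_of_nonneg_of_nonpos (Real.exp_pos _).le (by linarith)
    · positivity

/-- Weighted two-term Cauchy-Schwarz (Sedrakyan). -/
lemma div_weighted_le (a x y s t q r : ℝ) (ha : 0 ≤ a) (hx : 0 < x) (hy : 0 < y)
    (hs : 0 ≤ s) (ht : 0 ≤ t) (hst : s + t = 1) (hq : s * q + t * r = 1) :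
    a / (s * x + t * y) ≤ s * q ^ 2 * (a / x) + t * r ^ 2 * (a / y) := by
  have hz : 0 < s * x + t * y := by
    rcases hs.eq_or_lt with h | h
    · subst h
      have : t = 1 := by linarith
      subst this; linarith
    · positivity
  have key : 1 ≤ (s * q ^ 2 / x + t * r ^ 2 / y) * (s * x + t * y) := by
    have e : (s * q ^ 2 / x + t * r ^ 2 / y) * (s * x + t * y)
        = (s * q + t * r) ^ 2 + s * t * (q * y - r * x) ^ 2 / (x * y) := by
      field_simp
      ring
    rw [e, hq]
    have : 0 ≤ s * t * (q * y - r * x) ^ 2 / (x * y) := by positivity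
    linarith
  rw [div_le_iff₀ hz]
  have e2 : (s * q ^ 2 * (a / x) + t * r ^ 2 * (a / y)) * (s * x + t * y)
      = a * ((s * q ^ 2 / x + t * r ^ 2 / y) * (s * x + t * y)) := by ring
  rw [e2]
  nlinarith

theorem cost_exp_concave_on_restricted_simplex
    (n k : ℕ) (hn : 0 < n) (hk : 0 < k)
    (L γ : ℝ) (hL : 0 < L) (hγ0 : 0 < γ) (hγ1 : γ ≤ 1)
    (p : Fin k → Fin n → ℝ)
    (hp0 : ∀ j i, 0 ≤ p j i) (hp1 : ∀ j, ∑ i, p j i = 1)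
    (hpunif : ∀ i, p (lastIdx k hk) i = 1 / n)
    (ℓ : Fin n → ℝ) (hℓ : ∀ i, (ℓ i) ^ 2 ≤ L) :
    ConcaveOn ℝ (restSimplex k hk γ)
      (fun w => Real.exp (-(2 * γ / ((n : ℝ) ^ 2 * L)) *
        ∑ i, (ℓ i) ^ 2 / (∑ j, w j * p j i))) := by
  have hn' : (0 : ℝ) < n := by exact_mod_cast hn
  have hconv : Convex ℝ (restSimplex k hk γ) := by
    rintro x ⟨⟨hx0, hx1⟩, hxγ⟩ y ⟨⟨hy0, hy1⟩, hyγ⟩ s t hs ht hst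
    refine ⟨⟨fun j => ?_, ?_⟩, ?_⟩
    · have := mul_nonneg hs (hx0 j)
      have := mul_nonneg ht (hy0 j)
      simp only [Pi.add_apply, Pi.smul_apply, smul_eq_mul]
      linarith
    · simp only [Pi.add_apply, Pi.smul_apply, smul_eq_mul]
      rw [Finset.sum_add_distrib, ← Finset.mul_sum, ← Finset.mul_sum, hx1, hy1]
      linarith
    · have h1 := mul_le_mul_of_nonneg_left hxγ hs
      have h2 := mul_le_mul_of_nonneg_left hyγ ht
      simp only [Pi.add_apply, Pi.smul_apply, smul_eq_mul]
      have : γ = s * γ + t * γ := by rw [← add_mul, hst, one_mul]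
      linarith
  have hlow : ∀ w ∈ restSimplex k hk γ, ∀ i, γ / n ≤ ∑ j, w j * p j i := by
    rintro w ⟨⟨hw0, hw1⟩, hwγ⟩ i
    have h1 : w (lastIdx k hk) * p (lastIdx k hk) i ≤ ∑ j, w j * p j i :=
      Finset.single_le_sum (f := fun j => w j * p j i)
        (fun j _ => mul_nonneg (hw0 j) (hp0 j i)) (Finset.mem_univ _)
    rw [hpunif] at h1
    have h2 : γ * (1 / n) ≤ w (lastIdx k hk) * (1 / n) :=
      mul_le_mul_of_nonneg_right hwγ (by positivity)
    have h3 : γ / n = γ * (1 / n) := by ring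
    linarith
  have hlow0 : (0 : ℝ) < γ / n := by positivity
  by_cases hz : ∀ i, ℓ i = 0
  · simp only [hz]
    simpa using concaveOn_const (1 : ℝ) hconv
  push Not at hz
  obtain ⟨i₀, hi₀⟩ := hz
  have hpos : ∀ w ∈ restSimplex k hk γ, 0 < ∑ i, (ℓ i) ^ 2 / (∑ j, w j * p j i) := by
    intro w hw
    apply Finset.sum_pos'
    · intro i _
      exact div_nonneg (sq_nonneg _) (hlow0.le.trans (hlow w hw i))
    · exact ⟨i₀, Finset.mem_univ _, div_pos (by positivity) (hlow0.trans_le (hlow w hw i₀))⟩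
  have hup : ∀ w ∈ restSimplex k hk γ,
      ∑ i, (ℓ i) ^ 2 / (∑ j, w j * p j i) ≤ (n : ℝ) ^ 2 * L / γ := by
    intro w hw
    have h1 : ∀ i ∈ (Finset.univ : Finset (Fin n)),
        (ℓ i) ^ 2 / (∑ j, w j * p j i) ≤ L / (γ / n) := fun i _ =>
      div_le_div₀ hL.le (hℓ i) hlow0 (hlow w hw i)
    refine (Finset.sum_le_sum h1).trans (le_of_eq ?_)
    rw [Finset.sum_const, Finset.card_univ, Fintype.card_fin, nsmul_eq_mul]
    field_simp
  refine ⟨hconv, ?_⟩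
  intro x hx y hy s t hs ht hst
  have hA := hpos x hx
  have hB := hpos y hy
  have hAu := hup x hx
  have hBu := hup y hy
  have hsum : ∀ q r : ℝ, s * q + t * r = 1 →
      ∑ i, (ℓ i) ^ 2 / (∑ j, (s • x + t • y) j * p j i) ≤
      s * q ^ 2 * (∑ i, (ℓ i) ^ 2 / (∑ j, x j * p j i)) +
      t * r ^ 2 * (∑ i, (ℓ i) ^ 2 / (∑ j, y j * p j i)) := by
    intro q r hqr
    rw [Finset.mul_sum, Finset.mul_sum, ← Finset.sum_add_distrib]
    refine Finset.sum_le_sum fun i _ => ?_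
    have e : ∑ j, (s • x + t • y) j * p j i
        = s * (∑ j, x j * p j i) + t * (∑ j, y j * p j i) := by
      rw [Finset.mul_sum, Finset.mul_sum, ← Finset.sum_add_distrib]
      refine Finset.sum_congr rfl fun j _ => ?_
      simp only [Pi.add_apply, Pi.smul_apply, smul_eq_mul]
      ring
    rw [e]
    exact div_weighted_le _ _ _ _ _ _ _ (sq_nonneg _) (hlow0.trans_le (hlow x hx i))
      (hlow0.trans_le (hlow y hy i)) hs ht hst hqr
  simp only [smul_eq_mul]
  generalize (∑ i, (ℓ i) ^ 2 / (∑ j, x j * p j i)) = A at *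
  generalize (∑ i, (ℓ i) ^ 2 / (∑ j, y j * p j i)) = B at *
  generalize (∑ i, (ℓ i) ^ 2 / (∑ j, (s • x + t • y) j * p j i)) = C at *
  have hα : 0 < 2 * γ / ((n : ℝ) ^ 2 * L) := by positivity
  have hM : (n : ℝ) ^ 2 * L / γ = 2 / (2 * γ / ((n : ℝ) ^ 2 * L)) := by
    field_simp
  rw [hM] at hAu hBu
  generalize 2 * γ / ((n : ℝ) ^ 2 * L) = α at *
  rw [le_div_iff₀ hα] at hAu hBu
  have hD : 0 < s / A + t / B := by
    rcases hs.eq_or_lt with h | h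
    · have : t = 1 := by linarith
      rw [← h, this]; simpa using hB
    · positivity
  have hC : C ≤ (s / A + t / B)⁻¹ := by
    refine (hsum (1 / (A * (s / A + t / B))) (1 / (B * (s / A + t / B))) ?_).trans (le_of_eq ?_)
    · have : s * (1 / (A * (s / A + t / B))) + t * (1 / (B * (s / A + t / B)))
          = (s / A + t / B) * (s / A + t / B)⁻¹ := by
        simp only [one_div, mul_inv, div_eq_mul_inv]
        ring
      rw [this, mul_inv_cancel₀ hD.ne']
    · generalize hDD : s / A + t / B = D at *
      have : s * (1 / (A * D)) ^ 2 * A + t * (1 / (B * D)) ^ 2 * B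
          = (s / A + t / B) / D ^ 2 := by
        field_simp
      rw [this, hDD]
      field_simp
  have hmem : ∀ A : ℝ, 0 < A → A * α ≤ 2 → (α * A)⁻¹ ∈ Set.Ici (1 / 2 : ℝ) := by
    intro A h0 h
    rw [Set.mem_Ici, ← one_div]
    exact one_div_le_one_div_of_le (by positivity) (by linarith)
  have h := concave_exp_neg_inv.2 (hmem A hA hAu) (hmem B hB hBu) hs ht hst
  simp only [smul_eq_mul, inv_inv] at h
  have e : s * (α * A)⁻¹ + t * (α * B)⁻¹ = α⁻¹ * (s / A + t / B) := by
    simp only [mul_inv, div_eq_mul_inv]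
    ring
  rw [e, mul_inv, inv_inv] at h
  rw [neg_mul, neg_mul, neg_mul]
  refine h.trans (Real.exp_le_exp.2 (neg_le_neg ?_))
  exact mul_le_mul_of_nonneg_left hC hα.le
end

section
/- (Exp-concavity of the partial-information cost estimate.) Fix u ∈ Δ'_k, an index i ∈ {1,…,n}, and ℓ ∈ ℝ with ℓ² ≤ L. Then the function w ↦ exp(−(2γ²/(n²L)) · ℓ²/((uᵀp(i))·(wᵀp(i)))) is concave on Δ'_k; i.e., the estimated cost f̃(w) = ℓ²/((uᵀp(i))(wᵀp(i))) is (2γ²/(n²L))-exp-concave on Δ'_k. -/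
open Finset

lemma exp_neg_div_concave (a c : ℝ) (ha : 0 < a) (hc : 0 ≤ c) (hca : c ≤ 2 * a) :
    ConcaveOn ℝ (Set.Ici a) (fun x : ℝ => Real.exp (-c * x⁻¹)) := by
  have h1 : ∀ x : ℝ, 0 < x → HasDerivAt (fun x : ℝ => Real.exp (-c * x⁻¹))
      (Real.exp (-c * x⁻¹) * (-c * (-(x ^ 2)⁻¹))) x := fun x hx =>
    ((hasDerivAt_inv hx.ne').const_mul (-c)).exp
  have h2 : ∀ x : ℝ, 0 < x → HasDerivAt
      (fun x : ℝ => Real.exp (-c * x⁻¹) * (-c * (-(x ^ 2)⁻¹)))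
      (Real.exp (-c * x⁻¹) * (c * (c - 2 * x) / x ^ 4)) x := fun x hx => by
    have h3 := (((hasDerivAt_pow 2 x).fun_inv (by positivity)).fun_neg).const_mul (-c)
    refine ((h1 x hx).fun_mul h3).congr_deriv ?_
    field_simp
    ring
  refine concaveOn_of_hasDerivWithinAt2_nonpos (convex_Ici a)
    (f' := fun x : ℝ => Real.exp (-c * x⁻¹) * (-c * (-(x ^ 2)⁻¹)))
    (f'' := fun x : ℝ => Real.exp (-c * x⁻¹) * (c * (c - 2 * x) / x ^ 4)) ?_ ?_ ?_ ?_
  · intro x hx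
    exact (h1 x (ha.trans_le hx)).continuousAt.continuousWithinAt
  · intro x hx
    exact (h1 x (ha.trans_le (interior_subset hx))).hasDerivWithinAt
  · intro x hx
    exact (h2 x (ha.trans_le (interior_subset hx))).hasDerivWithinAt
  · intro x hx
    have hx' : a ≤ x := interior_subset hx
    have hx0 : 0 < x := ha.trans_le hx'
    refine mul_nonpos_of_nonneg_of_nonpos (Real.exp_pos _).le ?_
    refine div_nonpos_of_nonpos_of_nonneg ?_ (by positivity)
    exact mul_nonpos_of_nonneg_of_nonpos hc (by linarith)

theorem estimated_cost_exp_concave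
    (n k : ℕ) (hn : 0 < n) (hk : 0 < k)
    (L γ : ℝ) (hL : 0 < L) (hγ0 : 0 < γ) (hγ1 : γ ≤ 1)
    (p : Fin k → Fin n → ℝ)
    (hp0 : ∀ j i, 0 ≤ p j i) (hp1 : ∀ j, ∑ i, p j i = 1)
    (hpunif : ∀ i, p (lastIdx k hk) i = 1 / n)
    (u : Fin k → ℝ) (hu : u ∈ restSimplex k hk γ)
    (i : Fin n)
    (ℓ : ℝ) (hℓ : ℓ ^ 2 ≤ L) :
    ConcaveOn ℝ (restSimplex k hk γ)
      (fun w => Real.exp (-(2 * γ ^ 2 / ((n : ℝ) ^ 2 * L)) *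
        (ℓ ^ 2 / ((∑ j, u j * p j i) * (∑ j, w j * p j i))))) := by
  have hn' : (0 : ℝ) < n := by exact_mod_cast hn
  have key : ∀ w ∈ restSimplex k hk γ, γ / n ≤ ∑ j, w j * p j i := by
    rintro w ⟨⟨hw0, _⟩, hwγ⟩
    have h1 : w (lastIdx k hk) * p (lastIdx k hk) i ≤ ∑ j, w j * p j i :=
      Finset.single_le_sum (f := fun j => w j * p j i)
        (fun j _ => mul_nonneg (hw0 j) (hp0 j i)) (Finset.mem_univ _)
    refine le_trans ?_ h1
    rw [hpunif, mul_one_div]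
    gcongr
  have hconv : Convex ℝ (restSimplex k hk γ) := by
    rintro x ⟨⟨hx0, hx1⟩, hx2⟩ y ⟨⟨hy0, hy1⟩, hy2⟩ a b ha hb hab
    refine ⟨⟨fun j => ?_, ?_⟩, ?_⟩
    · exact add_nonneg (mul_nonneg ha (hx0 j)) (mul_nonneg hb (hy0 j))
    · simp only [Pi.add_apply, Pi.smul_apply, smul_eq_mul, Finset.sum_add_distrib,
        ← Finset.mul_sum, hx1, hy1, mul_one, hab]
    · simp only [Pi.add_apply, Pi.smul_apply, smul_eq_mul]
      calc γ = a * γ + b * γ := by rw [← add_mul, hab, one_mul]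
        _ ≤ _ := by gcongr
  have hU := key u hu
  set U := ∑ j, u j * p j i with hUdef
  have hg : 0 < γ / n := by positivity
  have hU0 : 0 < U := hg.trans_le hU
  set c := 2 * γ ^ 2 / ((n : ℝ) ^ 2 * L) * (ℓ ^ 2 / U) with hc
  have hc0 : 0 ≤ c := by positivity
  have hca : c ≤ 2 * (γ / n) := by
    have h1 : c = 2 * (γ / n) * ((γ / n) / U * (ℓ ^ 2 / L)) := by
      rw [hc]; field_simp
    rw [h1]
    have h2 : (γ / n) / U ≤ 1 := (div_le_one hU0).2 hU
    have h3 : ℓ ^ 2 / L ≤ 1 := (div_le_one hL).2 hℓ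
    have h4 : (γ / n) / U * (ℓ ^ 2 / L) ≤ 1 := mul_le_one₀ h2 (by positivity) h3
    exact mul_le_of_le_one_right (by positivity) h4
  have hcc := exp_neg_div_concave (γ / n) c hg hc0 hca
  have heq : ∀ w : Fin k → ℝ, -(2 * γ ^ 2 / ((n : ℝ) ^ 2 * L)) *
        (ℓ ^ 2 / (U * (∑ j, w j * p j i))) = -c * (∑ j, w j * p j i)⁻¹ := by
    intro w
    rw [hc, div_mul_eq_div_div (ℓ ^ 2), div_eq_mul_inv (ℓ ^ 2 / U)]
    ring
  refine ⟨hconv, fun x hx y hy a b ha hb hab => ?_⟩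
  have h := hcc.2 (key x hx) (key y hy) ha hb hab
  have hlin : ∑ j, (a • x + b • y) j * p j i
      = a • (∑ j, x j * p j i) + b • (∑ j, y j * p j i) := by
    simp only [Pi.add_apply, Pi.smul_apply, smul_eq_mul, Finset.mul_sum,
      ← Finset.sum_add_distrib]
    exact Finset.sum_congr rfl fun j _ => by ring
  beta_reduce
  rw [heq, heq, heq, hlin]
  exact h
end

section
/- (Correctness of the two-stage projection onto the restricted simplex, Lemma 6.) Let γ ∈ (0,1], w ∈ ℝ^k, let x_* be the minimizer of ‖x − w‖² over Δ_k, and let x'_* be the minimizer of ‖x − w‖² over Δ'_k. If x_*(k) ≥ γ then x'_* = x_*. Otherwise, x'_*(k) = γ and the first k−1 coordinates of x'_* equal the minimizer of ‖y − (w(1),…,w(k−1))‖² over the scaled simplex {y ∈ ℝ^{k−1} : y(j) ≥ 0 for all j, ∑_{j=1}^{k−1} y(j) = 1 − γ}. -/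
open Finset

/-- The probability simplex in Euclidean space `ℝ^k`. -/
def simplexE (k : ℕ) : Set (EuclideanSpace ℝ (Fin k)) :=
  {x | (∀ j, 0 ≤ x j) ∧ ∑ j, x j = 1}

/-- The restricted simplex in Euclidean space. -/
def restSimplexE (k : ℕ) (hk : 0 < k) (γ : ℝ) : Set (EuclideanSpace ℝ (Fin k)) :=
  {x ∈ simplexE k | γ ≤ x (lastIdx k hk)}

/-- The scaled simplex in `ℝ^{k-1}`: nonnegative vectors summing to `1 - γ`. -/
def scaledSimplexE (m : ℕ) (γ : ℝ) : Set (EuclideanSpace ℝ (Fin m)) :=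
  {y | (∀ j, 0 ≤ y j) ∧ ∑ j, y j = 1 - γ}

lemma norm_comb_aux {n : ℕ} (a b w : EuclideanSpace ℝ (Fin n)) (t : ℝ) :
    ‖((1 - t) • a + t • b) - w‖ ^ 2
      = (1 - t) * ‖a - w‖ ^ 2 + t * ‖b - w‖ ^ 2 - t * (1 - t) * ‖a - b‖ ^ 2 := by
  simp only [EuclideanSpace.real_norm_sq_eq, Finset.mul_sum, ← Finset.sum_add_distrib,
    ← Finset.sum_sub_distrib]
  refine Finset.sum_congr rfl fun i _ => ?_
  simp
  ring

/-- If `b` is at least as good as `a`, and a strict convex combination is no better than `a`,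
then `a = b`. -/
lemma eq_of_comb_aux {n : ℕ} (a b w : EuclideanSpace ℝ (Fin n)) (t : ℝ) (h0 : 0 < t) (h1 : t < 1)
    (hba : ‖b - w‖ ^ 2 ≤ ‖a - w‖ ^ 2)
    (hm : ‖a - w‖ ^ 2 ≤ ‖((1 - t) • a + t • b) - w‖ ^ 2) : a = b := by
  rw [norm_comb_aux] at hm
  have hp : 0 < t * (1 - t) := mul_pos h0 (by linarith)
  have h3 : t * (1 - t) * ‖a - b‖ ^ 2 ≤ 0 := by nlinarith
  have h4 : ‖a - b‖ ^ 2 ≤ 0 := by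
    by_contra! h
    nlinarith [mul_pos hp h]
  have h5 : ‖a - b‖ = 0 := by nlinarith [norm_nonneg (a - b), sq_nonneg ‖a - b‖]
  exact sub_eq_zero.mp (norm_eq_zero.mp h5)

lemma comb_mem_aux {n : ℕ} (s : ℝ) (a b : EuclideanSpace ℝ (Fin n)) (t : ℝ) (h0 : 0 ≤ t)
    (h1 : t ≤ 1) (ha : (∀ j, 0 ≤ a j) ∧ ∑ j, a j = s) (hb : (∀ j, 0 ≤ b j) ∧ ∑ j, b j = s) :
    (∀ j, 0 ≤ ((1 - t) • a + t • b) j) ∧ ∑ j, ((1 - t) • a + t • b) j = s := by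
  constructor
  · intro j
    have := mul_nonneg (sub_nonneg.mpr h1) (ha.1 j)
    have := mul_nonneg h0 (hb.1 j)
    simp
    linarith
  · simp only [PiLp.add_apply, PiLp.smul_apply, smul_eq_mul, Finset.sum_add_distrib,
      ← Finset.mul_sum, ha.2, hb.2]
    ring

theorem two_stage_projection_correct
    (k : ℕ) (hk2 : 2 ≤ k)
    (γ : ℝ) (hγ0 : 0 < γ) (hγ1 : γ ≤ 1)
    (w : EuclideanSpace ℝ (Fin k))
    (xstar : EuclideanSpace ℝ (Fin k))
    (hxs : xstar ∈ simplexE k)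
    (hxsmin : ∀ x ∈ simplexE k, ‖xstar - w‖ ^ 2 ≤ ‖x - w‖ ^ 2)
    (xstar' : EuclideanSpace ℝ (Fin k))
    (hxs' : xstar' ∈ restSimplexE k (by omega) γ)
    (hxsmin' : ∀ x ∈ restSimplexE k (by omega) γ, ‖xstar' - w‖ ^ 2 ≤ ‖x - w‖ ^ 2)
    (wfront : EuclideanSpace ℝ (Fin (k - 1)))
    (hwfront : ∀ j : Fin (k - 1), wfront j = w (Fin.castLE (Nat.sub_le k 1) j))
    (ystar : EuclideanSpace ℝ (Fin (k - 1)))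
    (hys : ystar ∈ scaledSimplexE (k - 1) γ)
    (hysmin : ∀ y ∈ scaledSimplexE (k - 1) γ, ‖ystar - wfront‖ ^ 2 ≤ ‖y - wfront‖ ^ 2) :
    (γ ≤ xstar (lastIdx k (by omega)) → xstar' = xstar) ∧
    (xstar (lastIdx k (by omega)) < γ →
      xstar' (lastIdx k (by omega)) = γ ∧
      ∀ j : Fin (k - 1), xstar' (Fin.castLE (Nat.sub_le k 1) j) = ystar j) := by
  obtain ⟨m, rfl⟩ : ∃ m, k = m + 1 := ⟨k - 1, by omega⟩
  have hl : lastIdx (m + 1) (by omega) = Fin.last m := rfl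
  change EuclideanSpace ℝ (Fin m) at wfront ystar
  change ∀ j : Fin m, wfront j = w j.castSucc at hwfront
  change ystar ∈ scaledSimplexE m γ at hys
  change ∀ y ∈ scaledSimplexE m γ, _ at hysmin
  constructor
  · intro h
    refine eq_of_comb_aux xstar' xstar w (1 / 2) (by norm_num) (by norm_num) (hxsmin _ hxs'.1)
      (hxsmin' _ ⟨comb_mem_aux 1 _ _ _ (by norm_num) (by norm_num) hxs'.1 hxs, ?_⟩)
    have := hxs'.2
    simp
    linarith
  · intro h
    have hγ : xstar' (lastIdx (m + 1) (by omega)) = γ := by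
      by_contra hne
      have hlt : γ < xstar' (lastIdx (m + 1) (by omega)) := lt_of_le_of_ne hxs'.2 (Ne.symm hne)
      set p := xstar' (lastIdx (m + 1) (by omega)) with hp
      set q := xstar (lastIdx (m + 1) (by omega)) with hq
      have hpq : 0 < p - q := by linarith
      have ht0 : 0 < (p - γ) / (p - q) := div_pos (by linarith) hpq
      have ht1 : (p - γ) / (p - q) < 1 := by rw [div_lt_one hpq]; linarith
      have heq := eq_of_comb_aux xstar' xstar w ((p - γ) / (p - q)) ht0 ht1
        (hxsmin _ hxs'.1)
        (hxsmin' _ ⟨comb_mem_aux 1 _ _ _ ht0.le ht1.le hxs'.1 hxs, by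
          simp only [PiLp.add_apply, PiLp.smul_apply, smul_eq_mul, ← hp, ← hq]
          apply le_of_eq
          field_simp
          ring⟩)
      rw [heq] at hp
      linarith
    refine ⟨hγ, ?_⟩
    rw [hl] at hγ
    let f : EuclideanSpace ℝ (Fin m) := WithLp.toLp 2 fun j => xstar' j.castSucc
    let g : EuclideanSpace ℝ (Fin (m + 1)) :=
      WithLp.toLp 2 (Fin.snoc (α := fun _ => ℝ) (fun j => ystar j) γ)
    have hgc : ∀ j : Fin m, g j.castSucc = ystar j := fun j => by simp [g]
    have hgl : g (Fin.last m) = γ := by simp [g]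
    have hf : f ∈ scaledSimplexE m γ := by
      refine ⟨fun j => hxs'.1.1 _, ?_⟩
      have := hxs'.1.2
      rw [Fin.sum_univ_castSucc, hγ] at this
      change ∑ j : Fin m, xstar' j.castSucc = _
      linarith
    have hg : g ∈ restSimplexE (m + 1) (by omega) γ := by
      refine ⟨⟨fun j => ?_, ?_⟩, ?_⟩
      · refine Fin.lastCases ?_ (fun i => ?_) j
        · rw [hgl]; exact hγ0.le
        · rw [hgc]; exact hys.1 i
      · rw [Fin.sum_univ_castSucc, hgl]
        simp only [hgc]
        rw [hys.2]; ring
      · rw [hl, hgl]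
    have hle : ‖f - wfront‖ ^ 2 ≤ ‖ystar - wfront‖ ^ 2 := by
      have h1 := hxsmin' g hg
      rw [EuclideanSpace.real_norm_sq_eq, EuclideanSpace.real_norm_sq_eq,
        Fin.sum_univ_castSucc, Fin.sum_univ_castSucc] at h1
      simp only [PiLp.sub_apply, hgc, hgl, hγ] at h1
      rw [EuclideanSpace.real_norm_sq_eq, EuclideanSpace.real_norm_sq_eq]
      simp only [PiLp.sub_apply, hwfront, f]
      linarith
    have hfy : ystar = f :=
      eq_of_comb_aux ystar f wfront (1 / 2) (by norm_num) (by norm_num) hle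
        (hysmin _ (comb_mem_aux (1 - γ) _ _ _ (by norm_num) (by norm_num) hys hf))
    intro j
    rw [hfy]
    rfl
end
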